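/- Fix an integer L ≥ 3 and a real λ ≥ 0. For each n, let u₁, …, u_n be i.i.d. uniform on {0, …, L−1}, let n_ℓ = #{j : u_j = ℓ}, and set S_L = ((L−1)/2) Σ_{ℓ=0}^{L−1} n_ℓ² − (1/2) Σ_{j≠k} n_j n_k. Then for every function D : ℕ → ℕ with D(n)³/n → 0 as n → ∞, there exists N₀ such that for all n ≥ N₀: Σ_{d=0}^{D(n)} (λ^{2d} / (n^d d!)) · E[S_L^d] ≤ Σ_{d=0}^{D(n)} λ^{2d} (d+1)^{2L}. -/

import Mathlib

open MeasureTheory Filter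

/-- Number of coordinates of `u : Fin n → Fin L` equal to `ℓ`. -/
def cntL (L n : ℕ) (u : Fin n → Fin L) (ℓ : ℕ) : ℕ :=
  (Finset.univ.filter fun j => (u j : ℕ) = ℓ).card

/-- `S_L = ((L-1)/2) ∑_ℓ n_ℓ² − (1/2) ∑_{j≠k} n_j n_k` for the counts of `u`. -/
noncomputable def SL (L n : ℕ) (u : Fin n → Fin L) : ℝ :=
  ((L : ℝ) - 1) / 2 * ∑ ℓ ∈ Finset.range L, (cntL L n u ℓ : ℝ) ^ 2
    - 1 / 2 * ∑ j ∈ Finset.range L, ∑ k ∈ Finset.range L,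
        (if j ≠ k then (cntL L n u j : ℝ) * (cntL L n u k : ℝ) else 0)

lemma cnt_sum (L n : ℕ) (u : Fin n → Fin L) :
    ∑ l ∈ Finset.range L, (cntL L n u l : ℝ) = n := by
  have h : (∑ l ∈ Finset.range L, cntL L n u l) = n := by
    unfold cntL
    have := Finset.card_eq_sum_card_fiberwise (s := (Finset.univ : Finset (Fin n)))
      (t := Finset.range L) (f := fun j => (u j : ℕ)) (by intro j _; simp)
    simpa using this.symm
  exact_mod_cast h

lemma SL_eq (L n : ℕ) (u : Fin n → Fin L) :
    SL L n u = ((L : ℝ) * ∑ l ∈ Finset.range L, (cntL L n u l : ℝ) ^ 2 - (n : ℝ) ^ 2) / 2 := by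
  have h1 : ∑ j ∈ Finset.range L, ∑ k ∈ Finset.range L,
        (if j ≠ k then (cntL L n u j : ℝ) * (cntL L n u k : ℝ) else 0)
      = (n : ℝ) ^ 2 - ∑ l ∈ Finset.range L, (cntL L n u l : ℝ) ^ 2 := by
    rw [← cnt_sum L n u, sq, Finset.sum_mul_sum, ← Finset.sum_sub_distrib]
    refine Finset.sum_congr rfl fun j hj => ?_
    have : (cntL L n u j : ℝ) ^ 2 = ∑ k ∈ Finset.range L,
        (if j = k then (cntL L n u j : ℝ) * (cntL L n u k : ℝ) else 0) := by
      rw [Finset.sum_ite_eq, if_pos hj, sq]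
    rw [this, ← Finset.sum_sub_distrib]
    refine Finset.sum_congr rfl fun k _ => ?_
    by_cases h : j = k <;> simp [h]
  unfold SL
  rw [h1]; ring

lemma cnt_cons (L n : ℕ) (u : Fin n → Fin L) (a : Fin L) (l : ℕ) :
    cntL L (n+1) (Fin.cons a u : Fin (n+1) → Fin L) l
      = cntL L n u l + if (a : ℕ) = l then 1 else 0 := by
  unfold cntL
  rw [Finset.card_filter, Finset.card_filter, Fin.sum_univ_succ]
  simp [add_comm]

/-- increment -/
noncomputable def ww (L n : ℕ) (u : Fin n → Fin L) (a : ℕ) : ℝ :=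
  (L : ℝ) * cntL L n u a - n + ((L : ℝ) - 1) / 2

lemma SL_cons (L n : ℕ) (u : Fin n → Fin L) (a : Fin L) :
    SL L (n+1) (Fin.cons a u : Fin (n+1) → Fin L) = SL L n u + ww L n u a := by
  rw [SL_eq, SL_eq]
  have : ∑ l ∈ Finset.range L, (cntL L (n+1) (Fin.cons a u : Fin (n+1) → Fin L) l : ℝ) ^ 2
      = ∑ l ∈ Finset.range L, (cntL L n u l : ℝ) ^ 2 + (2 * cntL L n u a + 1) := by
    have h2 : (2 * (cntL L n u a : ℝ) + 1) = ∑ l ∈ Finset.range L,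
        (if (a : ℕ) = l then (2 * (cntL L n u l : ℝ) + 1) else 0) := by
      rw [Finset.sum_ite_eq, if_pos (by simp)]
    rw [h2, ← Finset.sum_add_distrib]
    refine Finset.sum_congr rfl fun k _ => ?_
    rw [cnt_cons]
    by_cases h : (a : ℕ) = k <;> simp [h] <;> ring
  rw [this]; unfold ww; push_cast; ring

lemma ww_sum (L n : ℕ) (u : Fin n → Fin L) :
    ∑ a ∈ Finset.range L, ww L n u a = L * (((L : ℝ) - 1) / 2) := by
  unfold ww
  rw [Finset.sum_add_distrib, Finset.sum_sub_distrib, ← Finset.mul_sum, cnt_sum]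
  simp

lemma ww_sq (L n : ℕ) (u : Fin n → Fin L) :
    ∑ a ∈ Finset.range L, (ww L n u a)^2
      = L * (2 * SL L n u + (((L : ℝ) - 1) / 2)^2) := by
  have : ∀ a, (ww L n u a)^2 = (L:ℝ)^2 * (cntL L n u a : ℝ)^2
      + (2 * L * (((L : ℝ) - 1) / 2 - n)) * cntL L n u a + (((L : ℝ) - 1) / 2 - n)^2 := by
    intro a; unfold ww; ring
  simp_rw [this]
  rw [Finset.sum_add_distrib, Finset.sum_add_distrib, ← Finset.mul_sum, ← Finset.mul_sum,
    cnt_sum, SL_eq]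
  simp; ring

lemma SL_nonneg (L n : ℕ) (hL : 0 < L) (u : Fin n → Fin L) : 0 ≤ SL L n u := by
  have h : ∑ a ∈ Finset.range L, ((L:ℝ) * cntL L n u a - n)^2 = L * (2 * SL L n u) := by
    have : ∀ a, ((L:ℝ) * cntL L n u a - n)^2 = (L:ℝ)^2 * (cntL L n u a : ℝ)^2
      - (2 * L * n) * cntL L n u a + (n:ℝ)^2 := by
      intro a; ring
    simp_rw [this]
    rw [Finset.sum_add_distrib, Finset.sum_sub_distrib, ← Finset.mul_sum, ← Finset.mul_sum,
      cnt_sum, SL_eq]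
    simp; ring
  have h0 : 0 ≤ ∑ a ∈ Finset.range L, ((L:ℝ) * cntL L n u a - n)^2 :=
    Finset.sum_nonneg fun _ _ => sq_nonneg _
  rw [h] at h0
  have hl : (0:ℝ) < L := by exact_mod_cast hL
  have := nonneg_of_mul_nonneg_right h0 hl
  linarith

lemma exp_cubic (t : ℝ) (ht : |t| ≤ 1) : Real.exp t ≤ 1 + t + t^2/2 + |t|^3 := by
  have h := Real.exp_bound ht (n := 3) (by norm_num)
  simp [Finset.sum_range_succ, Nat.factorial] at h
  have h2 := (abs_le.1 h).2
  have : 0 ≤ |t|^3 := by positivity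
  norm_num at h2
  linarith

/-- pointwise step with `d = e + 2` -/
lemma pt (e : ℕ) (R w κ : ℝ) (hκ : 0 < κ) (hw : w^2 ≤ κ * R)
    (hR : κ * ((e:ℝ)+2)^2 ≤ R) :
    (R + w)^(e+2) ≤ R^e * (R^2 + ((e:ℝ)+2) * w * R + ((e:ℝ)+2)^2 * w^2/2 + ((e:ℝ)+2) * R
      + κ^3 * ((e:ℝ)+2)^5/4) := by
  set d : ℝ := (e:ℝ)+2 with hd
  have hd2 : 2 ≤ d := by rw [hd]; linarith [Nat.cast_nonneg (α := ℝ) e]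
  have hR0 : 0 < R := lt_of_lt_of_le (by positivity) hR
  have hdw : |d * w| ≤ R := by
    apply abs_le_of_sq_le_sq _ hR0.le
    calc (d*w)^2 = d^2 * w^2 := by ring
      _ ≤ d^2 * (κ * R) := by gcongr
      _ = (κ * d^2) * R := by ring
      _ ≤ R * R := by gcongr
      _ = R^2 := by ring
  set x := w / R with hx
  have hwx : w = x * R := by rw [hx]; field_simp
  have hdx : |d * x| ≤ 1 := by
    rw [hx, ← mul_div_assoc, abs_div, abs_of_pos hR0, div_le_one hR0]; exact hdw
  have hx1 : 0 ≤ 1 + x := by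
    have h3 := (abs_le.1 hdx).1
    by_contra hc
    push Not at hc
    nlinarith
  have h1 : (1 + x)^(e+2) ≤ 1 + d*x + (d*x)^2/2 + |d*x|^3 := by
    refine le_trans ?_ (exp_cubic _ hdx)
    calc (1+x)^(e+2) ≤ (Real.exp x)^(e+2) := by
          gcongr; linarith [Real.add_one_le_exp x]
      _ = Real.exp (d*x) := by rw [← Real.exp_nat_mul]; push_cast; rw [hd]
  have h2 : (R+w)^(e+2) = R^e * (R^2 * (1+x)^(e+2)) := by
    rw [hwx, show R + x*R = R*(1+x) by ring, mul_pow, pow_add]; ring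
  rw [h2]
  gcongr
  have h4 : R^2 * |d*x|^3 ≤ d * R + κ^3 * d^5/4 := by
    have e1 : |w| = |x| * R := by rw [hwx, abs_mul, abs_of_pos hR0]
    have e2 : |w|^2 ≤ κ * R := by rw [sq_abs]; exact hw
    have e0 : 0 ≤ |w| := abs_nonneg _
    have e5 : 0 ≤ |x| := abs_nonneg _
    rw [abs_mul, abs_of_pos (by linarith : 0 < d)]
    have e3 : R^2 * (d * |x|)^3 = d^3 * |w|^2 * |x| := by rw [e1]; ring
    rw [e3]
    calc d^3 * |w|^2 * |x| ≤ d^3 * (κ * R) * |x| := by gcongr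
      _ = d * (κ * d^2 * |w|) := by rw [e1]; ring
      _ ≤ d * (|w|^2/κ + κ^3 * d^4/4) := by
          gcongr
          have : |w|^2/κ + κ^3 * d^4/4 - κ * d^2 * |w| = (|w| - κ^2*d^2/2)^2/κ := by
            field_simp; ring
          have : 0 ≤ (|w| - κ^2*d^2/2)^2/κ := by positivity
          linarith
      _ ≤ d * (R + κ^3 * d^4/4) := by
          gcongr
          rw [div_le_iff₀ hκ]; linarith
      _ = _ := by ring
  calc R^2 * (1+x)^(e+2) ≤ R^2 * (1 + d*x + (d*x)^2/2 + |d*x|^3) := by gcongr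
    _ = R^2 + d * w * R + d^2 * w^2/2 + R^2 * |d*x|^3 := by rw [hwx]; ring
    _ ≤ _ := by linarith

lemma pt_mean (L n e : ℕ) (hL : 3 ≤ L) (u : Fin n → Fin L) (σ : ℝ)
    (hσ : 2 * (L:ℝ)^2 * ((e:ℝ)+2)^2 ≤ σ) :
    (1/(L:ℝ)) * ∑ a : Fin L, (SL L (n+1) (Fin.cons a u : Fin (n+1) → Fin L) + σ)^(e+2)
     ≤ (SL L n u + σ)^(e+2) + ((e:ℝ)+2) * ((e:ℝ)+1+L) * (SL L n u + σ)^(e+1)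
      + 3 * (L:ℝ)^3 * ((e:ℝ)+2)^5 * (SL L n u + σ)^e := by
  have hl : (3:ℝ) ≤ L := by exact_mod_cast hL
  have he : (0:ℝ) ≤ e := Nat.cast_nonneg e
  have hS := SL_nonneg L n (by omega) u
  set S := SL L n u
  set R := S + σ with hRdef
  set d : ℝ := (e:ℝ)+2 with hd
  have hd2 : 2 ≤ d := by linarith
  have hσ2 : 2*(L:ℝ)^2 ≤ σ := by
    refine le_trans ?_ hσ
    have : 1 ≤ d^2 := by nlinarith
    nlinarith [sq_nonneg (L:ℝ)]
  have hR0 : 0 ≤ R := by nlinarith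
  have hpt : ∀ a ∈ Finset.range L, (R + ww L n u a)^(e+2) ≤
      R^e * (R^2 + d * ww L n u a * R + d^2 * (ww L n u a)^2/2 + d * R
      + (2*L)^3 * d^5/4) := by
    intro a ha
    apply pt e R _ (2*L) (by linarith)
    · have h1 : (ww L n u a)^2 ≤ ∑ a ∈ Finset.range L, (ww L n u a)^2 :=
        Finset.single_le_sum (f := fun a => (ww L n u a)^2) (fun _ _ => sq_nonneg _) ha
      rw [ww_sq] at h1
      refine h1.trans ?_
      rw [mul_comm (2:ℝ) (L:ℝ), mul_assoc]
      gcongr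
      change 2 * S + _ ≤ _
      nlinarith
    · have : 2*(L:ℝ)*d^2 ≤ 2*(L:ℝ)^2*d^2 := by
        gcongr; nlinarith
      linarith
  have hsum : ∑ a : Fin L, (SL L (n+1) (Fin.cons a u : Fin (n+1) → Fin L) + σ)^(e+2)
      = ∑ a ∈ Finset.range L, (R + ww L n u a)^(e+2) := by
    rw [Finset.sum_range]
    refine Finset.sum_congr rfl fun a _ => ?_
    rw [SL_cons]; congr 1; rw [hRdef]; ring
  rw [hsum]
  have hb := Finset.sum_le_sum hpt
  have hrhs : ∑ a ∈ Finset.range L, R^e * (R^2 + d * ww L n u a * R + d^2 * (ww L n u a)^2/2 + d * R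
      + (2*L)^3 * d^5/4) = L * (R^e * (R^2 + d * (((L : ℝ) - 1) / 2) * R
        + d^2 * (2 * S + (((L : ℝ) - 1) / 2)^2)/2 + d * R + (2*L)^3 * d^5/4)) := by
    rw [← Finset.mul_sum]
    simp_rw [Finset.sum_add_distrib, ← Finset.sum_div, ← Finset.sum_mul, ← Finset.mul_sum,
      ww_sum, ww_sq]
    simp
    have hSS : SL L n u = S := rfl
    rw [hSS]; ring
  rw [hrhs] at hb
  calc _ ≤ (1/(L:ℝ)) * _ := mul_le_mul_of_nonneg_left hb (by positivity)
    _ = R^e * (R^2 + d * (((L : ℝ) - 1) / 2) * R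
        + d^2 * (2 * S + (((L : ℝ) - 1) / 2)^2)/2 + d * R + (2*L)^3 * d^5/4) := by
          field_simp
    _ ≤ R^e * (R^2 + d * ((e:ℝ)+1+L) * R + 3 * (L:ℝ)^3 * d^5) := by
          refine mul_le_mul_of_nonneg_left ?_ (by positivity)
          have hSR : S ≤ R := by nlinarith
          have a1 : d^2 * S ≤ d^2 * R := by gcongr
          have a2 : d^2 * (((L:ℝ)-1)/2)^2/2 ≤ (L:ℝ)^3 * d^5 := by
            have : d^2 ≤ d^5 := pow_le_pow_right₀ (by linarith) (by norm_num)
            have : (((L:ℝ)-1)/2)^2/2 ≤ (L:ℝ)^3 := by nlinarith [sq_nonneg (L:ℝ)]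
            calc d^2 * (((L:ℝ)-1)/2)^2/2 = (((L:ℝ)-1)/2)^2/2 * d^2 := by ring
              _ ≤ _ := by gcongr
          have a3 : d * (((L:ℝ)-1)/2) * R + d^2 * R + d * R ≤ d * ((e:ℝ)+1+L) * R := by
            have : d * R * (((L:ℝ)-1)/2 + d + 1) ≤ d * R * ((e:ℝ)+1+L) := by
              refine mul_le_mul_of_nonneg_left ?_ (by positivity)
              linarith
            linarith
          linarith
    _ = _ := by ring

/-- averaged moment -/
noncomputable def mom (L n : ℕ) (σ : ℝ) (d : ℕ) : ℝ :=
  (1/(L:ℝ))^n * ∑ u : Fin n → Fin L, (SL L n u + σ)^d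

lemma mom_succ (L n : ℕ) (σ : ℝ) (d : ℕ) : mom L (n+1) σ d =
    (1/(L:ℝ))^n * ∑ u : Fin n → Fin L,
      ((1/(L:ℝ)) * ∑ a : Fin L, (SL L (n+1) (Fin.cons a u : Fin (n+1) → Fin L) + σ)^d) := by
  unfold mom
  rw [← (Fin.consEquiv (fun _ : Fin (n+1) => Fin L)).sum_comp, Fintype.sum_prod_type_right,
    ← Finset.mul_sum, ← mul_assoc, ← pow_succ]
  rfl

lemma mom_step (L n e : ℕ) (hL : 3 ≤ L) (σ : ℝ)
    (hσ : 2 * (L:ℝ)^2 * ((e:ℝ)+2)^2 ≤ σ) :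
    mom L (n+1) σ (e+2) ≤ mom L n σ (e+2) + ((e:ℝ)+2) * ((e:ℝ)+1+L) * mom L n σ (e+1)
      + 3 * (L:ℝ)^3 * ((e:ℝ)+2)^5 * mom L n σ e := by
  rw [mom_succ]
  have := Finset.sum_le_sum (s := (Finset.univ : Finset (Fin n → Fin L)))
    (fun u _ => pt_mean L n e hL u σ hσ)
  refine (mul_le_mul_of_nonneg_left this (by positivity)).trans (le_of_eq ?_)
  rw [Finset.sum_add_distrib, Finset.sum_add_distrib, ← Finset.mul_sum, ← Finset.mul_sum]
  unfold mom; ring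

lemma mom_zero_d (L n : ℕ) (hL : 3 ≤ L) (σ : ℝ) : mom L n σ 0 = 1 := by
  have hl : (3:ℝ) ≤ L := by exact_mod_cast hL
  unfold mom
  simp
  field_simp

lemma mom_one (L n : ℕ) (hL : 3 ≤ L) (σ : ℝ) :
    mom L (n+1) σ 1 = mom L n σ 1 + ((L:ℝ)-1)/2 := by
  have hl : (3:ℝ) ≤ L := by exact_mod_cast hL
  have h0 := mom_zero_d L n hL σ
  rw [mom_succ]
  have : ∀ u : Fin n → Fin L, ((1/(L:ℝ)) * ∑ a : Fin L,
      (SL L (n+1) (Fin.cons a u : Fin (n+1) → Fin L) + σ)^1)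
      = (SL L n u + σ)^1 + ((L:ℝ)-1)/2 * (SL L n u + σ)^0 := by
    intro u
    have h := ww_sum L n u
    rw [Finset.sum_range] at h
    simp_rw [SL_cons, pow_one, Finset.sum_add_distrib, h]
    simp; field_simp; ring
  simp_rw [this]
  rw [Finset.sum_add_distrib, ← Finset.mul_sum, mul_add]
  unfold mom at h0 ⊢
  linear_combination ((L:ℝ)-1)/2 * h0

lemma SL_zero (L : ℕ) (u : Fin 0 → Fin L) : SL L 0 u = 0 := by
  rw [SL_eq]; simp [cntL]

lemma bern (x y : ℝ) (hx : 0 ≤ x) (hy : 0 ≤ y) (m : ℕ) :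
    x^(m+1) + ((m:ℝ)+1) * y * x^m ≤ (x+y)^(m+1) := by
  induction m with
  | zero => simp
  | succ m ih =>
    have := mul_le_mul_of_nonneg_right ih (by positivity : 0 ≤ x + y)
    rw [pow_succ (x+y) (m+1)]
    refine le_trans ?_ this
    have h : 0 ≤ ((m:ℝ)+1) * y * x^m * y := by positivity
    push_cast
    have e : (x^(m+1) + ((m:ℝ)+1) * y * x^m) * (x+y)
      = x^(m+1+1) + ((m:ℝ)+1+1)*y*x^(m+1) + ((m:ℝ)+1) * y * x^m * y := by ring
    rw [e]; linarith

lemma mom_bound (L E : ℕ) (hL : 3 ≤ L) (n : ℕ) : ∀ d ≤ E,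
    mom L n (2 * (L:ℝ)^2 * (E:ℝ)^2) d ≤
      (L.ascFactorial d : ℝ) * ((n:ℝ) + 2 * (L:ℝ)^2 * (E:ℝ)^2 + 12 * (L:ℝ)^3 * E * d)^d := by
  have hl : (3:ℝ) ≤ L := by exact_mod_cast hL
  set σ := 2 * (L:ℝ)^2 * (E:ℝ)^2 with hσ
  have hσ0 : 0 ≤ σ := by positivity
  induction n with
  | zero =>
    intro d _
    unfold mom
    simp only [SL_zero, pow_zero, one_mul, zero_add]
    simp
    have h1 : (1:ℝ) ≤ L.ascFactorial d := by
      exact_mod_cast Nat.succ_le_of_lt (by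
        have := Nat.ascFactorial_pos (L-1) d
        rwa [Nat.sub_add_cancel (by omega)] at this)
    calc σ^d = 1 * σ^d := by ring
      _ ≤ _ := by
        gcongr
        have : 0 ≤ 12 * (L:ℝ)^3 * E * d := by positivity
        linarith
  | succ n ih =>
    intro d hd
    match d, hd with
    | 0, _ => rw [mom_zero_d L _ hL]; simp
    | 1, hd =>
      rw [mom_one L n hL]
      have := ih 1 hd
      simp [Nat.ascFactorial_succ] at this ⊢
      nlinarith
    | e+2, hd =>
      have hE : ((e:ℝ)+2) ≤ E := by exact_mod_cast hd
      have hs := mom_step L n e hL σ (by rw [hσ]; gcongr)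
      have i2 := ih (e+2) hd
      have i1 := ih (e+1) (by omega)
      have i0 := ih e (by omega)
      have he : (0:ℝ) ≤ e := Nat.cast_nonneg e
      set A : ℝ := (L.ascFactorial e : ℝ) with hA
      have hA0 : 0 ≤ A := by positivity
      have A1 : (L.ascFactorial (e+1) : ℝ) = (L + e) * A := by
        rw [Nat.ascFactorial_succ]; push_cast; rfl
      have A2 : (L.ascFactorial (e+2) : ℝ) = (L + (e+1)) * ((L + e) * A) := by
        rw [Nat.ascFactorial_succ, Nat.cast_mul, A1]; push_cast; rfl
      rw [A2] at i2 ⊢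
      rw [A1] at i1
      push_cast at i2 i1 ⊢
      set c : ℝ := 12 * (L:ℝ)^3 * E with hc
      have hc0 : 0 ≤ c := by positivity
      set X : ℝ := (n:ℝ) + σ + c * e with hX
      have hX0 : 0 ≤ X := by positivity
      have e1 : (n:ℝ) + σ + c * (e+1) = X + c := by rw [hX]; ring
      have e2 : (n:ℝ) + σ + c * (e+2) = X + 2*c := by rw [hX]; ring
      have e3 : (n:ℝ) + 1 + σ + c * (e+2) = (X + 2*c) + 1 := by rw [hX]; ring
      rw [e1] at i1; rw [e2] at i2; rw [e3]
      have b1 := bern (X+2*c) 1 (by positivity) (by norm_num) (e+1)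
      have b2 := bern (X+c) c (by positivity) hc0 e
      rw [show X + c + c = X + 2*c by ring] at b2
      push_cast at b1
      have b3 : X^e ≤ (X+c)^e := by gcongr; linarith
      have k : 3 * (L:ℝ)^3 * ((e:ℝ)+2)^5 ≤
          (L + (e+1)) * (L + e) * ((e+2) * ((e+1) * c)) := by
        set d : ℝ := (e:ℝ)+2
        have q1 : d ≤ L + (e+1) := by simp only [d]; linarith
        have q2 : d/2 ≤ L + e := by simp only [d]; linarith
        have q3 : d/2 ≤ e+1 := by simp only [d]; linarith
        have d0 : 0 ≤ d := by positivity
        calc 3 * (L:ℝ)^3 * d^5 = d * (d/2) * (d * (d/2 * (12*(L:ℝ)^3*d))) := by ring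
          _ ≤ _ := by rw [hc]; gcongr
      calc mom L (n+1) σ (e+2) ≤ _ := hs
        _ ≤ (L + (e+1)) * ((L + e) * A) * (X+2*c)^(e+2)
            + ((e:ℝ)+2) * ((e:ℝ)+1+L) * ((L + e) * A * (X+c)^(e+1))
            + ((L + (e+1)) * (L + e) * ((e+2) * ((e+1) * c))) * (A * (X+c)^e) := by
            have i0' : mom L n σ e ≤ A * (X+c)^e := i0.trans (by gcongr)
            have m0 : 0 ≤ mom L n σ e := by
              unfold mom
              refine mul_nonneg (by positivity) (Finset.sum_nonneg fun u _ => ?_)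
              have := SL_nonneg L n (by omega) u
              positivity
            gcongr
        _ = (L + (e+1)) * ((L + e) * A) * ((X+2*c)^(e+2)
            + (e+2) * ((X+c)^(e+1) + (e+1) * c * (X+c)^e)) := by ring
        _ ≤ (L + (e+1)) * ((L + e) * A) * ((X+2*c)^(e+2) + (e+2) * (X+2*c)^(e+1)) := by
            gcongr
        _ ≤ _ := by
            gcongr
            refine le_trans (le_of_eq ?_) b1
            ring

lemma int_eq (L n d : ℕ) (μu : Measure (Fin L)) [IsProbabilityMeasure μu]
    (hμu : ∀ k, μu {k} = 1 / (L : ENNReal)) :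
    ∫ u : Fin n → Fin L, SL L n u ^ d ∂(Measure.pi fun _ => μu) = mom L n 0 d := by
  rw [integral_fintype (Integrable.of_finite)]
  unfold mom
  rw [Finset.mul_sum]
  refine Finset.sum_congr rfl fun u _ => ?_
  rw [add_zero, measureReal_def, Measure.pi_singleton]
  simp [hμu]

lemma asc_bound (L d : ℕ) : (L+1).ascFactorial d ≤ d.factorial * (d+1)^L := by
  induction L with
  | zero => simp [Nat.one_ascFactorial]
  | succ L ih =>
    have h := Nat.succ_ascFactorial (L+1) d
    have h1 : (L+1) * (L+1+1).ascFactorial d ≤ (L+1) * (d.factorial * (d+1)^(L+1)) := by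
      have : L + 1 + d ≤ (L+1) * (d+1) := by nlinarith
      calc (L+1) * (L+1+1).ascFactorial d = (L+1+d) * (L+1).ascFactorial d := h
        _ ≤ ((L+1)*(d+1)) * (d.factorial * (d+1)^L) := Nat.mul_le_mul this ih
        _ = _ := by ring
    exact Nat.le_of_mul_le_mul_left h1 (by omega)

lemma term_bound (L n d : ℕ) (hL : 3 ≤ L) (hn : 0 < n) (hd : 1 ≤ d)
    (h : (2 * (L:ℝ)^2 + 12 * (L:ℝ)^3) * ((d:ℝ)^3 / n) ≤ 1/2) :
    mom L n 0 d ≤ ((n:ℝ)^d * d.factorial) * ((d:ℝ)+1)^(2*L) := by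
  have hn' : (0:ℝ) < n := by exact_mod_cast hn
  have hd' : (1:ℝ) ≤ d := by exact_mod_cast hd
  have h1 : mom L n 0 d ≤ mom L n (2 * (L:ℝ)^2 * (d:ℝ)^2) d := by
    unfold mom
    gcongr with u
    · have := SL_nonneg L n (by omega) u
      linarith
    · positivity
  have h2 := mom_bound L d hL n d le_rfl
  set C : ℝ := 2 * (L:ℝ)^2 + 12 * (L:ℝ)^3 with hC
  have hC0 : 0 ≤ C := by positivity
  have h3 : ((n:ℝ) + 2 * (L:ℝ)^2 * (d:ℝ)^2 + 12 * (L:ℝ)^3 * d * d)^d ≤ (n:ℝ)^d * 2 := by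
    have : (n:ℝ) + 2 * (L:ℝ)^2 * (d:ℝ)^2 + 12 * (L:ℝ)^3 * d * d = n * (1 + C * d^2/n) := by
      rw [hC]; field_simp; ring
    rw [this, mul_pow]
    gcongr
    calc (1 + C * d^2/n)^d ≤ (Real.exp (C * d^2/n))^d := by
          gcongr; linarith [Real.add_one_le_exp (C * (d:ℝ)^2/n)]
      _ = Real.exp (C * ((d:ℝ)^3/n)) := by rw [← Real.exp_nat_mul]; congr 1; ring
      _ ≤ 2 := by
          have hp : 0 ≤ C * ((d:ℝ)^3/n) := by positivity
          have := exp_cubic (C * ((d:ℝ)^3/n)) (by rw [abs_of_nonneg hp]; linarith)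
          rw [abs_of_nonneg hp] at this
          set t := C * ((d:ℝ)^3/n)
          have t2 : t^2 ≤ (1/2)^2 := by gcongr
          have t3 : t^3 ≤ (1/2)^3 := by gcongr
          linarith
  have h4 : (L.ascFactorial d : ℝ) ≤ d.factorial * ((d:ℝ)+1)^(L-1) := by
    have := asc_bound (L-1) d
    rw [Nat.sub_add_cancel (by omega)] at this
    exact_mod_cast this
  have h5 : ((d:ℝ)+1)^(L-1) * 2 ≤ ((d:ℝ)+1)^(2*L) := by
    calc ((d:ℝ)+1)^(L-1) * 2 ≤ ((d:ℝ)+1)^(L-1) * ((d:ℝ)+1) := by gcongr; linarith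
      _ = ((d:ℝ)+1)^(L-1+1) := by rw [pow_succ]
      _ ≤ _ := pow_le_pow_right₀ (by linarith) (by omega)
  calc mom L n 0 d ≤ _ := h1.trans h2
    _ ≤ (d.factorial * ((d:ℝ)+1)^(L-1)) * ((n:ℝ)^d * 2) := by gcongr
    _ = ((n:ℝ)^d * d.factorial) * (((d:ℝ)+1)^(L-1) * 2) := by ring
    _ ≤ _ := by gcongr

/-- **Bound on the low-degree likelihood ratio norm for synchronization over a
finite group of order `L`.** For `u₁,…,u_n` i.i.d. uniform on `{0,…,L−1}` and any
`D : ℕ → ℕ` with `D(n)³/n → 0`, eventually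
`∑_{d=0}^{D(n)} (λ^{2d}/(n^d d!)) E[S_L^d] ≤ ∑_{d=0}^{D(n)} λ^{2d} (d+1)^{2L}`. -/
theorem stmt13 (L : ℕ) (hL : 3 ≤ L) (lam : ℝ) (hlam : 0 ≤ lam)
    (μu : Measure (Fin L)) [IsProbabilityMeasure μu]
    (hμu : ∀ k, μu {k} = 1 / (L : ENNReal))
    (D : ℕ → ℕ)
    (hD : Tendsto (fun n => (D n : ℝ) ^ 3 / n) atTop (nhds 0)) :
    ∃ N₀ : ℕ, ∀ n ≥ N₀,
      ∑ d ∈ Finset.range (D n + 1),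
        lam ^ (2 * d) / ((n : ℝ) ^ d * d.factorial) *
          ∫ u : Fin n → Fin L, SL L n u ^ d ∂(Measure.pi fun _ => μu)
      ≤ ∑ d ∈ Finset.range (D n + 1), lam ^ (2 * d) * ((d : ℝ) + 1) ^ (2 * L) := by
  have hl : (3:ℝ) ≤ L := by exact_mod_cast hL
  set C : ℝ := 2 * (L:ℝ)^2 + 12 * (L:ℝ)^3 with hC
  have hC0 : 0 < C := by positivity
  have hev : ∀ᶠ n : ℕ in atTop, (D n : ℝ)^3 / n < 1/(2*C) :=
    hD.eventually (gt_mem_nhds (by positivity))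
  obtain ⟨N, hN⟩ := eventually_atTop.1 (hev.and (eventually_gt_atTop 0))
  refine ⟨N, fun n hn => ?_⟩
  obtain ⟨h1, h2⟩ := hN n hn
  have hn' : (0:ℝ) < n := by exact_mod_cast h2
  refine Finset.sum_le_sum fun d hd => ?_
  rw [int_eq L n d μu hμu, div_mul_eq_mul_div, mul_div_assoc]
  gcongr
  rw [div_le_iff₀' (by positivity)]
  rcases Nat.eq_zero_or_pos d with rfl | hd0
  · rw [mom_zero_d L n hL]; simp
  · apply term_bound L n d hL h2 hd0
    rw [← hC]
    have hdD : (d:ℝ) ≤ D n := by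
      have := Finset.mem_range.1 hd
      exact_mod_cast (by omega : d ≤ D n)
    calc C * ((d:ℝ)^3/n) ≤ C * ((D n:ℝ)^3/n) := by gcongr
      _ ≤ C * (1/(2*C)) := by gcongr
      _ = 1/2 := by field_simp
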